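/- For every ε with 0 < ε ≤ 1 and every real v with v² > (1 − ε)/(8 + ε), one has det(B^#(v, ε)) < 0. In particular det(B^#(v, ε)) < 0 whenever 0 < ε ≤ 1 and 1/8 < v² < 1/2. -/

import Mathlib

/-- `u = √(1 + v²)`. -/
noncomputable def uu (v : ℝ) : ℝ := Real.sqrt (1 + v ^ 2)

/-- The dissipation matrix `B^#(v, ε) = ε·B_visc − B₁ − (9ε/(4 − ε))·B₂`. -/
noncomputable def Bsharp (v ε : ℝ) : Matrix (Fin 2) (Fin 2) ℝ :=
  ε • !![(uu v) ^ 2 * v ^ 2, -(uu v) ^ 3 * v; -(uu v) ^ 3 * v, (uu v) ^ 4]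
    - !![16 * (uu v) ^ 2 * v ^ 2, -4 * (uu v) * v * (4 * v ^ 2 + 1);
         -4 * (uu v) * v * (4 * v ^ 2 + 1), (4 * v ^ 2 + 1) ^ 2]
    - (9 * ε / (4 - ε)) • !![((uu v) ^ 2 + v ^ 2) ^ 2, -2 * ((uu v) ^ 2 + v ^ 2) * (uu v) * v;
         -2 * ((uu v) ^ 2 + v ^ 2) * (uu v) * v, 4 * (uu v) ^ 2 * v ^ 2]

/-- The matrix `A(v)` of the scaled linearization. -/
noncomputable def Amat (v : ℝ) : Matrix (Fin 2) (Fin 2) ℝ :=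
  !![v * (6 * v ^ 2 + 5), -(uu v) * (6 * v ^ 2 + 1);
     -(uu v) * (6 * v ^ 2 + 1), 3 * v * (2 * v ^ 2 + 1)]

theorem uu_sq (v : ℝ) : uu v ^ 2 = 1 + v ^ 2 :=
  Real.sq_sqrt (by positivity)

theorem det_Bsharp (v ε : ℝ) (hε : ε ≠ 4) :
    (Bsharp v ε).det = 9 * ε / (4 - ε) * ((1 - ε) - (8 + ε) * v ^ 2) := by
  have h4 : 4 - ε ≠ 0 := sub_ne_zero.mpr hε.symm
  have hu := uu_sq v
  set c := 9 * ε / (4 - ε) with hc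
  have hε9 : 9 * ε = c * (4 - ε) := by rw [hc, div_mul_cancel₀ _ h4]
  -- `Bsharp` is a combination of three rank-one matrices, so its determinant
  -- is a combination of squares of `2 × 2` minors.
  have hdet : (Bsharp v ε).det =
      -(9 * ε) * (uu v ^ 2 * v ^ 2 * (4 * (uu v ^ 2 - v ^ 2) - 1) ^ 2 / 9)
        - ε * c * (uu v ^ 2 * (uu v ^ 2 - v ^ 2)) ^ 2
        + c * ((4 * v ^ 2 + 1) * (uu v ^ 2 + v ^ 2) - 8 * uu v ^ 2 * v ^ 2) ^ 2 := by
    simp only [Bsharp, ← hc, Matrix.det_fin_two, Matrix.sub_apply, Matrix.smul_apply,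
      Matrix.of_apply, Matrix.cons_val', Matrix.cons_val_zero, Matrix.cons_val_one,
      Matrix.cons_val_fin_one, smul_eq_mul]
    ring
  rw [hdet, hu, hε9]
  ring

/-- For `0 < ε ≤ 1` and `v² > (1 − ε)/(8 + ε)` one has `det B^#(v, ε) < 0`;
in particular this holds whenever `1/8 < v² < 1/2`. -/
theorem det_Bsharp_neg :
    (∀ ε v : ℝ, 0 < ε → ε ≤ 1 → (1 - ε) / (8 + ε) < v ^ 2 → (Bsharp v ε).det < 0) ∧
    (∀ ε v : ℝ, 0 < ε → ε ≤ 1 → 1 / 8 < v ^ 2 → v ^ 2 < 1 / 2 → (Bsharp v ε).det < 0) := by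
  have main : ∀ ε v : ℝ, 0 < ε → ε ≤ 1 → (1 - ε) / (8 + ε) < v ^ 2 → (Bsharp v ε).det < 0 := by
    intro ε v h0 h1 hv
    rw [det_Bsharp v ε (by linarith)]
    rw [div_lt_iff₀ (by linarith)] at hv
    exact mul_neg_of_pos_of_neg (div_pos (by linarith) (by linarith)) (by linarith)
  refine ⟨main, fun ε v h0 h1 hv _ => main ε v h0 h1 (lt_of_le_of_lt ?_ hv)⟩
  rw [div_le_div_iff₀ (by linarith) (by norm_num)]
  linarith
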